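/- arXiv:0708.3385 — 3 statements merged into one kernel-verified Lean document; each statement's English description precedes it below -/
import Mathlib

section
/- Set c = b⁻¹a⁻¹. For every integer n and every w ∈ F, the element (bⁿ)^w lies in H, and ψ((bⁿ)^w) = (cⁿ)^{ψ(w)} if w ∈ H, while ψ((bⁿ)^w) = (bⁿ)^{ψ(a⁻¹w)} if w ∉ H (note that a⁻¹w ∈ H when w ∉ H). -/
/-- F is the free group on two generators a and b. -/
abbrev F : Type := FreeGroup Bool

def a : F := FreeGroup.of false
def b : F := FreeGroup.of true

/-- The homomorphism F → ℤ/2ℤ sending a ↦ 1 and b ↦ 0. -/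
def toZ2 : F →* Multiplicative (ZMod 2) :=
  FreeGroup.lift fun s => Multiplicative.ofAdd (if s then (0 : ZMod 2) else 1)

/-- H is the kernel: the elements whose total exponent sum in a is even. -/
def H : Subgroup F := toZ2.ker

theorem mem_H_iff {w : F} : w ∈ H ↔ toZ2 w = 1 := MonoidHom.mem_ker

theorem toZ2_a : toZ2 a = Multiplicative.ofAdd 1 := by simp [toZ2, a]

theorem b_mem_H : b ∈ H := by simp [mem_H_iff, toZ2, b]

instance : H.Normal := inferInstanceAs toZ2.ker.Normal

theorem conj_mem_H {u : F} (hu : u ∈ H) (w : F) : w⁻¹ * u * w ∈ H := by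
  simpa using Subgroup.Normal.conj_mem inferInstance u hu w⁻¹

theorem a_inv_mul_mem_H {w : F} (hw : w ∉ H) : a⁻¹ * w ∈ H := by
  rw [mem_H_iff] at hw ⊢
  rw [map_mul, map_inv, toZ2_a]
  generalize toZ2 w = z at hw ⊢
  revert z
  decide

/-- A homomorphism on `H` carries conjugates of powers to conjugates of powers. -/
theorem map_conj_zpow (ψ : H →* F) (u v : H) (n : ℤ) {x : F}
    (hx : x = (v : F)⁻¹ * (u : F) ^ n * v) (h : x ∈ H) :
    ψ ⟨x, h⟩ = (ψ v)⁻¹ * ψ u ^ n * ψ v := by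
  have hv : (⟨x, h⟩ : H) = v⁻¹ * u ^ n * v := Subtype.ext (by simp [hx])
  simp [hv]

/-- With c = b⁻¹a⁻¹: for every n ∈ ℤ and w ∈ F, (bⁿ)^w ∈ H, a⁻¹w ∈ H whenever w ∉ H,
and ψ((bⁿ)^w) = (cⁿ)^{ψ(w)} if w ∈ H, while ψ((bⁿ)^w) = (bⁿ)^{ψ(a⁻¹w)} if w ∉ H. -/
theorem stmt11 (ψ : H →* F)
    (hψa2 : ∀ u : H, (u : F) = a ^ 2 → ψ u = 1)
    (hψb : ∀ u : H, (u : F) = b → ψ u = b⁻¹ * a⁻¹)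
    (hψc : ∀ u : H, (u : F) = a⁻¹ * b * a → ψ u = b)
    (n : ℤ) (w : F) :
    w⁻¹ * b ^ n * w ∈ H ∧
    (w ∉ H → a⁻¹ * w ∈ H) ∧
    ∀ h : w⁻¹ * b ^ n * w ∈ H,
      (∀ hw : w ∈ H,
        ψ ⟨w⁻¹ * b ^ n * w, h⟩ =
          (ψ ⟨w, hw⟩)⁻¹ * (b⁻¹ * a⁻¹) ^ n * ψ ⟨w, hw⟩) ∧
      (w ∉ H → ∀ hw : a⁻¹ * w ∈ H,
        ψ ⟨w⁻¹ * b ^ n * w, h⟩ =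
          (ψ ⟨a⁻¹ * w, hw⟩)⁻¹ * b ^ n * ψ ⟨a⁻¹ * w, hw⟩) := by
  refine ⟨conj_mem_H (H.zpow_mem b_mem_H n) w, a_inv_mul_mem_H,
    fun h => ⟨fun hw => ?_, fun _ hw => ?_⟩⟩
  · rw [map_conj_zpow ψ ⟨b, b_mem_H⟩ ⟨w, hw⟩ n rfl h, hψb ⟨b, b_mem_H⟩ rfl]
  · have hx : w⁻¹ * b ^ n * w = (a⁻¹ * w)⁻¹ * (a⁻¹ * b * a) ^ n * (a⁻¹ * w) := by
      have hc : (a⁻¹ * b * a) ^ n = a⁻¹ * b ^ n * a := by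
        simpa using conj_zpow (i := n) (a := a⁻¹) (b := b)
      rw [hc]
      group
    rw [map_conj_zpow ψ ⟨a⁻¹ * b * a, conj_mem_H b_mem_H a⟩ ⟨a⁻¹ * w, hw⟩ n hx h,
      hψc ⟨a⁻¹ * b * a, conj_mem_H b_mem_H a⟩ rfl]
end

section
/- Set c = b⁻¹a⁻¹. The map ψ̂ : F → F satisfies the following recursion relations for all w ∈ F: ψ̂(aw) = ψ̂(w) and ψ̂(a⁻¹w) = ψ̂(w) (regardless of whether w ∈ H); ψ̂(b^{±1}w) = c^{±1}·ψ̂(w) if w ∈ H and ψ̂(b^{±1}w) = b^{±1}·ψ̂(w) if w ∉ H; ψ̂(cw) = b⁻¹·ψ̂(w) if w ∈ H and ψ̂(cw) = c⁻¹·ψ̂(w) if w ∉ H; ψ̂(c⁻¹w) = c·ψ̂(w) if w ∈ H and ψ̂(c⁻¹w) = b·ψ̂(w) if w ∉ H. -/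
theorem a_mul_mem_H_iff (w : F) : a * w ∈ H ↔ w ∉ H := by
  have key : ∀ x : Multiplicative (ZMod 2),
      Multiplicative.ofAdd (1 : ZMod 2) * x = 1 ↔ ¬ x = 1 := by decide
  simpa [H, MonoidHom.mem_ker, toZ2, a] using key (toZ2 w)

theorem a_inv_mul_mem_H_iff (w : F) : a⁻¹ * w ∈ H ↔ w ∉ H := by
  have h := a_mul_mem_H_iff (a⁻¹ * w)
  rw [mul_inv_cancel_left] at h
  tauto

theorem a_sq_mem_H : a ^ 2 ∈ H := by
  rw [pow_two, a_mul_mem_H_iff, ← mul_one a, a_mul_mem_H_iff]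
  exact not_not.2 H.one_mem

theorem a_inv_mul_b_mul_a_mem_H : a⁻¹ * b * a ∈ H := by
  have : H.Normal := MonoidHom.normal_ker toZ2
  simpa using this.conj_mem b b_mem_H a⁻¹

/-- With c = b⁻¹a⁻¹: the recursion relations for the map ψ̂ : F → F. -/
theorem stmt12 (ψ : H →* F)
    (hψa2 : ∀ u : H, (u : F) = a ^ 2 → ψ u = 1)
    (hψb : ∀ u : H, (u : F) = b → ψ u = b⁻¹ * a⁻¹)
    (hψc : ∀ u : H, (u : F) = a⁻¹ * b * a → ψ u = b)
    (ψh : F → F)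
    (hψh₁ : ∀ (w : F) (h : w ∈ H), ψh w = ψ ⟨w, h⟩)
    (hψh₂ : ∀ (w : F), w ∉ H → ∀ h : a⁻¹ * w ∈ H, ψh w = ψ ⟨a⁻¹ * w, h⟩)
    (w : F) :
    (ψh (a * w) = ψh w) ∧
    (ψh (a⁻¹ * w) = ψh w) ∧
    ((w ∈ H → ψh (b * w) = (b⁻¹ * a⁻¹) * ψh w) ∧ (w ∉ H → ψh (b * w) = b * ψh w)) ∧
    ((w ∈ H → ψh (b⁻¹ * w) = (b⁻¹ * a⁻¹)⁻¹ * ψh w) ∧ (w ∉ H → ψh (b⁻¹ * w) = b⁻¹ * ψh w)) ∧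
    ((w ∈ H → ψh ((b⁻¹ * a⁻¹) * w) = b⁻¹ * ψh w) ∧
      (w ∉ H → ψh ((b⁻¹ * a⁻¹) * w) = (b⁻¹ * a⁻¹)⁻¹ * ψh w)) ∧
    ((w ∈ H → ψh ((b⁻¹ * a⁻¹)⁻¹ * w) = (b⁻¹ * a⁻¹) * ψh w) ∧
      (w ∉ H → ψh ((b⁻¹ * a⁻¹)⁻¹ * w) = b * ψh w)) := by
  have hb_iff (v : F) : b * v ∈ H ↔ v ∈ H := H.mul_mem_cancel_left b_mem_H
  have hb_inv_iff (v : F) : b⁻¹ * v ∈ H ↔ v ∈ H :=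
    H.mul_mem_cancel_left (H.inv_mem b_mem_H)
  have ha (v : F) : ψh (a * v) = ψh v := by
    by_cases hv : v ∈ H
    · have hav : a * v ∉ H := fun h => (a_mul_mem_H_iff v).1 h hv
      have hv' : a⁻¹ * (a * v) ∈ H := by rwa [inv_mul_cancel_left]
      rw [hψh₂ _ hav hv', hψh₁ _ hv]
      simp only [inv_mul_cancel_left]
    · have hv' := (a_inv_mul_mem_H_iff v).2 hv
      have hav := (a_mul_mem_H_iff v).2 hv
      have hmul : (⟨a * v, hav⟩ : H) = ⟨a ^ 2, a_sq_mem_H⟩ * ⟨a⁻¹ * v, hv'⟩ :=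
        Subtype.ext (by simp only [Subgroup.coe_mul]; group)
      rw [hψh₁ _ hav, hψh₂ _ hv hv', hmul, map_mul, hψa2 _ rfl, one_mul]
  have ha_inv (v : F) : ψh (a⁻¹ * v) = ψh v := by
    rw [← ha (a⁻¹ * v), mul_inv_cancel_left]
  have hb (v : F) (hv : v ∈ H) : ψh (b * v) = (b⁻¹ * a⁻¹) * ψh v := by
    have hmul : (⟨b * v, (hb_iff v).2 hv⟩ : H) = ⟨b, b_mem_H⟩ * ⟨v, hv⟩ := rfl
    rw [hψh₁ _ ((hb_iff v).2 hv), hψh₁ _ hv, hmul, map_mul, hψb _ rfl]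
  have hb' (v : F) (hv : v ∉ H) : ψh (b * v) = b * ψh v := by
    have hbv : b * v ∉ H := fun h => hv ((hb_iff v).1 h)
    have hv' := (a_inv_mul_mem_H_iff v).2 hv
    have hbv' := (a_inv_mul_mem_H_iff (b * v)).2 hbv
    have hmul : (⟨a⁻¹ * (b * v), hbv'⟩ : H) =
        ⟨a⁻¹ * b * a, a_inv_mul_b_mul_a_mem_H⟩ * ⟨a⁻¹ * v, hv'⟩ :=
      Subtype.ext (by simp only [Subgroup.coe_mul]; group)
    rw [hψh₂ _ hbv hbv', hψh₂ _ hv hv', hmul, map_mul, hψc _ rfl]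
  have hb_inv (v : F) (hv : v ∈ H) : ψh (b⁻¹ * v) = (b⁻¹ * a⁻¹)⁻¹ * ψh v := by
    rw [eq_inv_mul_iff_mul_eq, ← hb _ ((hb_inv_iff v).2 hv), mul_inv_cancel_left]
  have hb_inv' (v : F) (hv : v ∉ H) : ψh (b⁻¹ * v) = b⁻¹ * ψh v := by
    rw [eq_inv_mul_iff_mul_eq, ← hb' _ (mt (hb_inv_iff v).1 hv), mul_inv_cancel_left]
  refine ⟨ha w, ha_inv w, ⟨hb w, hb' w⟩, ⟨hb_inv w, hb_inv' w⟩, ⟨fun hw => ?_, fun hw => ?_⟩,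
    ⟨fun hw => ?_, fun hw => ?_⟩⟩
  · rw [mul_assoc, hb_inv' _ (fun h => (a_inv_mul_mem_H_iff w).1 h hw), ha_inv]
  · rw [mul_assoc, hb_inv _ ((a_inv_mul_mem_H_iff w).2 hw), ha_inv]
  · rw [mul_inv_rev, inv_inv, inv_inv, mul_assoc, ha, hb _ hw]
  · rw [mul_inv_rev, inv_inv, inv_inv, mul_assoc, ha, hb' _ hw]
end

section
/- For every natural number n there exists gₙ ∈ F such that b^{gₙ} belongs to dom(ψ^{∘n}) and ψ^{∘n}(b^{gₙ}) = b. -/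
/-- g ∈ dom(ψ^{∘k}): dom(ψ^{∘0}) = F and dom(ψ^{∘(k+1)}) = {g ∈ H : ψ(g) ∈ dom(ψ^{∘k})}. -/
def inDom (ψ : H →* F) : ℕ → F → Prop
  | 0, _ => True
  | k + 1, g => ∃ h : g ∈ H, inDom ψ k (ψ ⟨g, h⟩)

open scoped Classical in
/-- The iterate ψ^{∘k}: ψ^{∘0} = id and ψ^{∘(k+1)}(g) = ψ^{∘k}(ψ(g))
(with junk value 1 outside the domain). -/
noncomputable def iterPsi (ψ : H →* F) : ℕ → F → F
  | 0, g => g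
  | k + 1, g => if h : g ∈ H then iterPsi ψ k (ψ ⟨g, h⟩) else 1

theorem conj_b_mem_H (g : F) : g⁻¹ * b * g ∈ H := by
  have hb : toZ2 b = 1 := b_mem_H
  simp [H, MonoidHom.mem_ker, hb]

theorem psi_surjective (ψ : H →* F)
    (hψb : ∀ u : H, (u : F) = b → ψ u = b⁻¹ * a⁻¹)
    (hψc : ∀ u : H, (u : F) = a⁻¹ * b * a → ψ u = b) :
    Function.Surjective ψ := by
  have hb : b ∈ ψ.range := ⟨⟨_, conj_b_mem_H a⟩, hψc _ rfl⟩
  have hba : b⁻¹ * a⁻¹ ∈ ψ.range := ⟨⟨b, b_mem_H⟩, hψb _ rfl⟩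
  have ha : a ∈ ψ.range := by
    simpa using ψ.range.inv_mem (ψ.range.mul_mem hb hba)
  rw [← MonoidHom.range_eq_top, eq_top_iff, ← FreeGroup.closure_range_of Bool,
    Subgroup.closure_le]
  rintro _ ⟨_ | _, rfl⟩
  exacts [ha, hb]

/-- Writing `x = ψ h`, the conjugate of `b` by `a * h` maps to the conjugate of `b` by `x`. -/
theorem exists_psi_conj_b_eq (ψ : H →* F)
    (hψb : ∀ u : H, (u : F) = b → ψ u = b⁻¹ * a⁻¹)
    (hψc : ∀ u : H, (u : F) = a⁻¹ * b * a → ψ u = b) (x : F) :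
    ∃ g : F, ψ ⟨g⁻¹ * b * g, conj_b_mem_H g⟩ = x⁻¹ * b * x := by
  obtain ⟨h, rfl⟩ := psi_surjective ψ hψb hψc x
  refine ⟨a * h, ?_⟩
  have hconj : (⟨(a * h)⁻¹ * b * (a * h), conj_b_mem_H _⟩ : H) =
      h⁻¹ * ⟨a⁻¹ * b * a, conj_b_mem_H a⟩ * h := by
    ext1
    simp [mul_assoc]
  rw [hconj, map_mul, map_mul, map_inv, hψc ⟨_, conj_b_mem_H a⟩ rfl]

/-- For every n ∈ ℕ there exists gₙ ∈ F with b^{gₙ} ∈ dom(ψ^{∘n}) and ψ^{∘n}(b^{gₙ}) = b. -/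
theorem stmt17 (ψ : H →* F)
    (hψa2 : ∀ u : H, (u : F) = a ^ 2 → ψ u = 1)
    (hψb : ∀ u : H, (u : F) = b → ψ u = b⁻¹ * a⁻¹)
    (hψc : ∀ u : H, (u : F) = a⁻¹ * b * a → ψ u = b)
    (n : ℕ) :
    ∃ g : F, inDom ψ n (g⁻¹ * b * g) ∧ iterPsi ψ n (g⁻¹ * b * g) = b := by
  induction n with
  | zero => exact ⟨1, trivial, by simp [iterPsi]⟩
  | succ n ih =>
    obtain ⟨x, hdom, hiter⟩ := ih
    obtain ⟨g, hg⟩ := exists_psi_conj_b_eq ψ hψb hψc x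
    refine ⟨g, ⟨conj_b_mem_H g, by rwa [hg]⟩, ?_⟩
    rw [iterPsi, dif_pos (conj_b_mem_H g), hg, hiter]
end
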